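/- Let n ≥ 1, let P be a symmetric n×n real matrix with nonnegative entries whose row sums are all at most 1, let r̃ > 1 be a real number, and let γ ∈ (0,1). Then r̃·I − P and I − γ·P are invertible, and the real spectrum of (I − γ·P)⁻¹ equals the image of the real spectrum of (r̃·I − P)⁻¹ under the map f(μ) = [γ·(μ⁻¹ − r̃ + γ⁻¹)]⁻¹. -/

import Mathlib

open Matrix

theorem aux_unit {n : ℕ} (P : Matrix (Fin n) (Fin n) ℝ)
    (hP_nonneg : ∀ i j, 0 ≤ P i j)
    (hP_rowsum : ∀ i, ∑ j, P i j ≤ 1) (t : ℝ) (ht : 1 < t) :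
    IsUnit (t • (1 : Matrix (Fin n) (Fin n) ℝ) - P) := by
  rw [Matrix.isUnit_iff_isUnit_det, isUnit_iff_ne_zero]
  apply det_ne_zero_of_sum_row_lt_diag
  intro i
  have h1 : ∑ j ∈ Finset.univ.erase i, ‖(t • (1 : Matrix (Fin n) (Fin n) ℝ) - P) i j‖
      = ∑ j ∈ Finset.univ.erase i, P i j := by
    apply Finset.sum_congr rfl
    intro j hj
    have hij : i ≠ j := (Finset.ne_of_mem_erase hj).symm
    simp [Matrix.one_apply_ne hij, abs_of_nonneg (hP_nonneg i j)]
  rw [h1]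
  have h2 := Finset.add_sum_erase Finset.univ (fun j => P i j) (Finset.mem_univ i)
  have h3 := hP_rowsum i
  have h4 : (t • (1 : Matrix (Fin n) (Fin n) ℝ) - P) i i = t - P i i := by simp
  rw [h4]
  have := le_abs_self (t - P i i)
  rw [Real.norm_eq_abs]
  linarith

theorem aux_smul {n : ℕ} (A : Matrix (Fin n) (Fin n) ℝ) (c : ℝ) (hc : c ≠ 0) :
    IsUnit (c • A) ↔ IsUnit A := by
  simp [Matrix.isUnit_iff_isUnit_det, isUnit_iff_ne_zero, Matrix.det_smul, hc]

theorem aux_inv {n : ℕ} (A : Matrix (Fin n) (Fin n) ℝ) (hA : IsUnit A) (μ : ℝ) :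
    ¬ IsUnit (A⁻¹ - μ • (1 : Matrix (Fin n) (Fin n) ℝ)) ↔
      μ ≠ 0 ∧ ¬ IsUnit (A - μ⁻¹ • (1 : Matrix (Fin n) (Fin n) ℝ)) := by
  have hAi : IsUnit A⁻¹ := (Matrix.isUnit_nonsing_inv_iff).2 hA
  have hd := (Matrix.isUnit_iff_isUnit_det A).1 hA
  by_cases hμ : μ = 0
  · subst hμ
    simp [hAi]
  · have : A⁻¹ - μ • (1 : Matrix (Fin n) (Fin n) ℝ)
        = (-μ) • (A⁻¹ * (A - μ⁻¹ • (1 : Matrix (Fin n) (Fin n) ℝ))) := by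
      rw [mul_sub, Matrix.nonsing_inv_mul A hd, Matrix.mul_smul, mul_one, smul_sub, smul_smul]
      rw [neg_mul, mul_inv_cancel₀ hμ, neg_smul, neg_smul, one_smul]
      abel
    rw [this, aux_smul _ _ (neg_ne_zero.2 hμ), Matrix.isUnit_iff_isUnit_det, Matrix.det_mul,
      IsUnit.mul_iff, ← Matrix.isUnit_iff_isUnit_det, ← Matrix.isUnit_iff_isUnit_det]
    simp only [hAi, true_and, ne_eq, hμ, not_false_eq_true]

theorem stmt_1 (n : ℕ) (hn : 1 ≤ n) (P : Matrix (Fin n) (Fin n) ℝ)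
    (hP_symm : P.IsSymm)
    (hP_nonneg : ∀ i j, 0 ≤ P i j)
    (hP_rowsum : ∀ i, ∑ j, P i j ≤ 1)
    (rt γ : ℝ) (hrt : 1 < rt) (hγ0 : 0 < γ) (hγ1 : γ < 1) :
    IsUnit (rt • (1 : Matrix (Fin n) (Fin n) ℝ) - P) ∧
    IsUnit ((1 : Matrix (Fin n) (Fin n) ℝ) - γ • P) ∧
    {μ : ℝ | ¬ IsUnit (((1 : Matrix (Fin n) (Fin n) ℝ) - γ • P)⁻¹
        - μ • (1 : Matrix (Fin n) (Fin n) ℝ))}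
      = (fun μ : ℝ => (γ * (μ⁻¹ - rt + γ⁻¹))⁻¹) ''
        {μ : ℝ | ¬ IsUnit ((rt • (1 : Matrix (Fin n) (Fin n) ℝ) - P)⁻¹
          - μ • (1 : Matrix (Fin n) (Fin n) ℝ))} := by
  have hu := aux_unit P hP_nonneg hP_rowsum
  have hg : γ ≠ 0 := hγ0.ne'
  have key : ∀ c : ℝ, IsUnit ((1 : Matrix (Fin n) (Fin n) ℝ) - γ • P
      - c • (1 : Matrix (Fin n) (Fin n) ℝ)) ↔
      IsUnit (((1 - c) * γ⁻¹) • (1 : Matrix (Fin n) (Fin n) ℝ) - P) := by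
    intro c
    rw [← aux_smul (((1 - c) * γ⁻¹) • (1 : Matrix (Fin n) (Fin n) ℝ) - P) γ hg, smul_sub, smul_smul]
    have : γ * ((1 - c) * γ⁻¹) = 1 - c := by field_simp
    rw [this, sub_smul, one_smul, sub_right_comm]
  have h1 := hu rt hrt
  have h2 : IsUnit ((1 : Matrix (Fin n) (Fin n) ℝ) - γ • P) := by
    have := (key 0).2 (hu _ (by simpa using (one_lt_inv₀ hγ0).2 hγ1))
    simpa using this
  refine ⟨h1, h2, ?_⟩
  have key2 : ∀ c : ℝ, rt • (1 : Matrix (Fin n) (Fin n) ℝ) - P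
      - c • (1 : Matrix (Fin n) (Fin n) ℝ) = (rt - c) • (1 : Matrix (Fin n) (Fin n) ℝ) - P := by
    intro c
    rw [sub_smul, sub_right_comm]
  ext ν
  simp only [Set.mem_setOf_eq, Set.mem_image, aux_inv _ h1, aux_inv _ h2, key, key2]
  constructor
  · rintro ⟨hν, hs⟩
    have hc : (1 - ν⁻¹) * γ⁻¹ ≤ 1 := not_lt.1 fun h => hs (hu _ h)
    have hne : rt - (1 - ν⁻¹) * γ⁻¹ ≠ 0 := by linarith
    refine ⟨(rt - (1 - ν⁻¹) * γ⁻¹)⁻¹, ⟨inv_ne_zero hne, ?_⟩, ?_⟩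
    · rwa [inv_inv, sub_sub_cancel]
    · rw [inv_inv, inv_eq_iff_eq_inv]
      field_simp
      ring
  · rintro ⟨μ, ⟨hμ, hs⟩, rfl⟩
    have hc : rt - μ⁻¹ ≤ 1 := not_lt.1 fun h => hs (hu _ h)
    have hi := (one_lt_inv₀ hγ0).2 hγ1
    have hp : 0 < μ⁻¹ - rt + γ⁻¹ := by linarith
    refine ⟨inv_ne_zero (mul_pos hγ0 hp).ne', ?_⟩
    have : (1 - γ * (μ⁻¹ - rt + γ⁻¹)) * γ⁻¹ = rt - μ⁻¹ := by
      rw [mul_add, mul_inv_cancel₀ hg]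
      field_simp
      ring
    rwa [inv_inv, this]
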